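/- arXiv:math-ph/0410049 — 6 statements merged into one kernel-verified Lean document; each statement's English description precedes it below -/
import Mathlib

section
/- Let U and V be bounded linear operators on H. The real-linear map R(U,V) f = U f + V (J f) leaves the symplectic form invariant, i.e. ω(R(U,V) f, R(U,V) g) = ω(f, g) for all f, g ∈ H, if and only if U* U − Vᵀ V̄ = 1 and Uᵀ V̄ = V* U. -/
open ContinuousLinearMap
open scoped InnerProductSpace

variable {H : Type*} [NormedAddCommGroup H] [InnerProductSpace ℂ H] [CompleteSpace H]

/-- The complex conjugate `Ā := J ∘ A ∘ J` of a bounded operator with respect to the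
conjugation `J`. -/
noncomputable def conjOp (J : H →L⋆[ℂ] H) (A : H →L[ℂ] H) : H →L[ℂ] H :=
  (J.comp A).comp J

/-- The transpose `Aᵀ := J ∘ A* ∘ J` of a bounded operator with respect to the
conjugation `J`. -/
noncomputable def transp (J : H →L⋆[ℂ] H) (A : H →L[ℂ] H) : H →L[ℂ] H :=
  conjOp J (adjoint A)

/-- The pair `(U, V)` satisfies the symplectic relations:
`U U* − V V* = 1`, `U Vᵀ = V Uᵀ`, `U* U − Vᵀ V̄ = 1`, `Uᵀ V̄ = V* U`. -/
def SymplecticPair (J : H →L⋆[ℂ] H) (U V : H →L[ℂ] H) : Prop :=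
  U ∘L adjoint U - V ∘L adjoint V = 1 ∧
  U ∘L transp J V = V ∘L transp J U ∧
  adjoint U ∘L U - transp J V ∘L conjOp J V = 1 ∧
  transp J U ∘L conjOp J V = adjoint V ∘L U

/-- A norm-preserving conjugate-linear map is antiunitary. -/
lemma inner_map_map_of_conjugation {E : Type*} [NormedAddCommGroup E]
    [InnerProductSpace ℂ E] (J : E →L⋆[ℂ] E) (hJnorm : ∀ x, ‖J x‖ = ‖x‖) (f g : E) :
    ⟪J f, J g⟫_ℂ = ⟪g, f⟫_ℂ := by
  have hre : ∀ x y : E, (⟪J x, J y⟫_ℂ).re = (⟪x, y⟫_ℂ).re := by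
    intro x y
    have h₁ := norm_add_sq (𝕜 := ℂ) (J x) (J y)
    have h₂ := norm_add_sq (𝕜 := ℂ) x y
    rw [← map_add, hJnorm, hJnorm, hJnorm] at h₁
    simp only [RCLike.re_to_complex] at h₁ h₂
    linarith
  have him := hre f (Complex.I • g)
  rw [← inner_conj_symm g f]
  apply Complex.ext
  · rw [Complex.conj_re]
    exact hre f g
  · simp only [map_smulₛₗ, Complex.conj_I, inner_smul_right] at him
    rw [Complex.conj_im]
    simpa using him

/-- A form that is linear in `g`, split into a part conjugate-linear in `f` and a part linear
in `f`, has vanishing imaginary part only if both parts vanish. -/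
lemma im_inner_add_inner_conj_eq_zero_iff {E : Type*} [NormedAddCommGroup E]
    [InnerProductSpace ℂ E] (J : E →L⋆[ℂ] E) (hJinv : ∀ x, J (J x) = x)
    (A B : E →L[ℂ] E) :
    (∀ f g : E, (⟪f, A g⟫_ℂ).im + (⟪J f, B g⟫_ℂ).im = 0) ↔ A = 0 ∧ B = 0 := by
  constructor
  · intro h
    have hrot : ∀ f g : E, (⟪f, A g⟫_ℂ).im - (⟪J f, B g⟫_ℂ).im = 0 := by
      intro f g
      have := h (Complex.I • f) (Complex.I • g)
      simpa [map_smulₛₗ, inner_smul_left, inner_smul_right, sub_eq_add_neg] using this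
    have vanish : ∀ T : E →L[ℂ] E, (∀ f g : E, (⟪f, T g⟫_ℂ).im = 0) → T = 0 := by
      intro T hT
      ext g
      have := hT (T g) (Complex.I • g)
      rw [map_smul, inner_smul_right, inner_self_eq_norm_sq_to_K] at this
      simpa [← Complex.ofReal_pow] using this
    refine ⟨vanish A fun f g => ?_, vanish B fun f g => ?_⟩
    · linarith [h f g, hrot f g]
    · have h₁ := h (J f) g
      have h₂ := hrot (J f) g
      rw [hJinv] at h₁ h₂
      linarith
  · rintro ⟨rfl, rfl⟩ f g
    simp

/-- The defect of invariance of the symplectic form under `f ↦ U f + V (J f)`. -/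
lemma im_inner_sub_im_inner_eq (J : H →L⋆[ℂ] H) (hJinv : ∀ x, J (J x) = x)
    (hJnorm : ∀ x, ‖J x‖ = ‖x‖) (U V : H →L[ℂ] H) (f g : H) :
    (⟪U f + V (J f), U g + V (J g)⟫_ℂ).im - (⟪f, g⟫_ℂ).im =
      (⟪f, (adjoint U ∘L U - transp J V ∘L conjOp J V - 1) g⟫_ℂ).im +
        (⟪J f, (adjoint V ∘L U - transp J U ∘L conjOp J V) g⟫_ℂ).im := by
  have hV : (⟪f, J (adjoint V (V (J g)))⟫_ℂ).im = -(⟪V (J f), V (J g)⟫_ℂ).im := by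
    rw [← hJinv f, inner_map_map_of_conjugation J hJnorm, adjoint_inner_left, hJinv,
      ← inner_conj_symm, Complex.conj_im]
  have hU : (⟪J f, J (adjoint U (V (J g)))⟫_ℂ).im = -(⟪U f, V (J g)⟫_ℂ).im := by
    rw [inner_map_map_of_conjugation J hJnorm, adjoint_inner_left, ← inner_conj_symm,
      Complex.conj_im]
  simp only [transp, conjOp, sub_apply, comp_apply, one_apply_eq_self, hJinv, inner_sub_right,
    inner_add_left, inner_add_right, Complex.add_im, Complex.sub_im, adjoint_inner_right, hV, hU]
  ring

/-- The real-linear map `R(U,V) f = U f + V (J f)` leaves the symplectic form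
`ω(f,g) = Im ⟪f,g⟫` invariant if and only if `U* U − Vᵀ V̄ = 1` and `Uᵀ V̄ = V* U`. -/
theorem statement0 (J : H →L⋆[ℂ] H) (hJinv : ∀ x, J (J x) = x) (hJnorm : ∀ x, ‖J x‖ = ‖x‖)
    (U V : H →L[ℂ] H) :
    (∀ f g : H, (⟪U f + V (J f), U g + V (J g)⟫_ℂ).im = (⟪f, g⟫_ℂ).im) ↔
      (adjoint U ∘L U - transp J V ∘L conjOp J V = 1 ∧
        transp J U ∘L conjOp J V = adjoint V ∘L U) := by
  rw [← sub_eq_zero (a := adjoint U ∘L U - transp J V ∘L conjOp J V),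
    eq_comm (a := transp J U ∘L conjOp J V), ← sub_eq_zero (a := adjoint V ∘L U),
    ← im_inner_add_inner_conj_eq_zero_iff J hJinv]
  simp only [← im_inner_sub_im_inner_eq J hJinv hJnorm, sub_eq_zero]
end

section
/- If the pair (U,V) of bounded linear operators on H satisfies the symplectic relations, then the pair (U*, −Vᵀ) also satisfies the symplectic relations and R(U*, −Vᵀ) is a two-sided inverse of R(U,V): for every f ∈ H one has U*(U f + V (J f)) − Vᵀ J(U f + V (J f)) = f and U(U* f − Vᵀ (J f)) + V J(U* f − Vᵀ (J f)) = f. -/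
open ContinuousLinearMap
open scoped InnerProductSpace

variable {H : Type*} [NormedAddCommGroup H] [InnerProductSpace ℂ H] [CompleteSpace H]

section Conjugation

variable {E : Type*} [NormedAddCommGroup E] [InnerProductSpace ℂ E]

/-- A conjugate-linear isometry reverses the inner product. -/
theorem inner_conj_conj (J : E →L⋆[ℂ] E) (hJnorm : ∀ x, ‖J x‖ = ‖x‖) (x y : E) :
    ⟪J x, J y⟫_ℂ = ⟪y, x⟫_ℂ := by
  have hadd : ‖J x + J y‖ = ‖x + y‖ := by rw [← map_add, hJnorm]
  have hsub : ‖J x - J y‖ = ‖x - y‖ := by rw [← map_sub, hJnorm]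
  have hI_sub : ‖J x - Complex.I • J y‖ = ‖x + Complex.I • y‖ := by
    rw [← hJnorm (x + _)]; simp [map_smulₛₗ, sub_eq_add_neg]
  have hI_add : ‖J x + Complex.I • J y‖ = ‖x - Complex.I • y‖ := by
    rw [← hJnorm (x - _)]; simp [map_smulₛₗ, sub_eq_add_neg]
  rw [← inner_conj_symm y x, inner_eq_sum_norm_sq_div_four (J x), inner_eq_sum_norm_sq_div_four x]
  simp only [RCLike.I_to_complex, hadd, hsub, hI_sub, hI_add]
  simp only [map_div₀, map_add, map_sub, map_mul, map_pow, Complex.coe_algebraMap,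
    Complex.conj_ofReal, Complex.conj_I, map_ofNat]
  ring

theorem conjOp_apply (J : E →L⋆[ℂ] E) (A : E →L[ℂ] E) (x : E) :
    conjOp J A x = J (A (J x)) := rfl

theorem conjOp_conjOp (J : E →L⋆[ℂ] E) (hJinv : ∀ x, J (J x) = x) (A : E →L[ℂ] E) :
    conjOp J (conjOp J A) = A := by
  ext x
  simp [conjOp_apply, hJinv]

theorem conjOp_neg (J : E →L⋆[ℂ] E) (A : E →L[ℂ] E) : conjOp J (-A) = -conjOp J A := by
  ext x
  simp [conjOp_apply]

theorem conjOp_comp (J : E →L⋆[ℂ] E) (hJinv : ∀ x, J (J x) = x) (A B : E →L[ℂ] E) :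
    conjOp J (A ∘L B) = conjOp J A ∘L conjOp J B := by
  ext x
  simp [conjOp_apply, hJinv]

end Conjugation

theorem adjoint_conjOp (J : H →L⋆[ℂ] H) (hJinv : ∀ x, J (J x) = x) (hJnorm : ∀ x, ‖J x‖ = ‖x‖)
    (A : H →L[ℂ] H) : adjoint (conjOp J A) = conjOp J (adjoint A) := by
  refine ((eq_adjoint_iff _ _).mpr fun x y => ?_).symm
  calc ⟪J (adjoint A (J x)), y⟫_ℂ = ⟪J (adjoint A (J x)), J (J y)⟫_ℂ := by rw [hJinv]
    _ = ⟪A (J y), J x⟫_ℂ := by rw [inner_conj_conj J hJnorm, adjoint_inner_right]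
    _ = ⟪J (J x), J (A (J y))⟫_ℂ := (inner_conj_conj J hJnorm _ _).symm
    _ = ⟪x, J (A (J y))⟫_ℂ := by rw [hJinv]

/-- If `(U,V)` satisfies the symplectic relations, then `(U*, −Vᵀ)` also does, and
`R(U*, −Vᵀ)` is a two-sided inverse of `R(U,V)`. -/
theorem statement1 (J : H →L⋆[ℂ] H) (hJinv : ∀ x, J (J x) = x) (hJnorm : ∀ x, ‖J x‖ = ‖x‖)
    (U V : H →L[ℂ] H) (h : SymplecticPair J U V) :
    SymplecticPair J (adjoint U) (-(transp J V)) ∧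
    (∀ f : H, adjoint U (U f + V (J f)) - transp J V (J (U f + V (J f))) = f) ∧
    (∀ f : H, U (adjoint U f - transp J V (J f)) + V (J (adjoint U f - transp J V (J f))) = f) := by
  obtain ⟨h₁, h₂, h₃, h₄⟩ := h
  have h₂' : conjOp J U ∘L adjoint V = conjOp J V ∘L adjoint U := by
    simpa only [transp, conjOp_comp J hJinv, conjOp_conjOp J hJinv] using congrArg (conjOp J) h₂
  have h₄' : adjoint U ∘L V = transp J V ∘L conjOp J U := by
    simpa only [transp, conjOp_comp J hJinv, conjOp_conjOp J hJinv] using congrArg (conjOp J) h₄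
  refine ⟨⟨?_, ?_, ?_, ?_⟩, fun f => ?_, fun f => ?_⟩
  · simpa [transp, adjoint_conjOp J hJinv hJnorm] using h₃
  · simpa [transp, adjoint_conjOp J hJinv hJnorm, conjOp_conjOp J hJinv, conjOp_neg] using h₄'
  · simpa [transp, adjoint_conjOp J hJinv hJnorm, conjOp_conjOp J hJinv, conjOp_neg] using h₁
  · simpa [transp, adjoint_conjOp J hJinv hJnorm, conjOp_conjOp J hJinv, conjOp_neg] using h₂'
  · have e₃ := congrArg (fun T : H →L[ℂ] H => T f) h₃
    have e₄ := congrArg (fun T : H →L[ℂ] H => T (J f)) h₄'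
    simp only [transp, conjOp_apply, hJinv, comp_apply, sub_apply, map_add] at e₃ e₄ ⊢
    rw [e₄]
    refine Eq.trans ?_ e₃
    abel
  · have e₁ := congrArg (fun T : H →L[ℂ] H => T f) h₁
    have e₂ := congrArg (fun T : H →L[ℂ] H => T (J f)) h₂
    simp only [transp, conjOp_apply, hJinv, comp_apply, sub_apply, map_sub] at e₁ e₂ ⊢
    rw [e₂]
    refine Eq.trans ?_ e₁
    abel
end

section
/- Let Z be a compact linear operator on a complex Hilbert space H. Then ‖Z‖ < 1 if and only if the operator 1 − Z Z* is positive definite, i.e. ‖f‖² − ‖Z* f‖² > 0 for every nonzero f ∈ H. -/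
open ContinuousLinearMap

/-- For a compact operator `Z` on a complex Hilbert space, `‖Z‖ < 1` if and only if
`1 − Z Z*` is positive definite, i.e. `‖f‖² − ‖Z* f‖² > 0` for every nonzero `f`. -/
theorem statement7 {H : Type*} [NormedAddCommGroup H] [InnerProductSpace ℂ H] [CompleteSpace H]
    (Z : H →L[ℂ] H) (hZ : IsCompactOperator (⇑Z)) :
    ‖Z‖ < 1 ↔ ∀ f : H, f ≠ 0 → 0 < ‖f‖ ^ 2 - ‖adjoint Z f‖ ^ 2 := by
  constructor
  · intro h f hf
    have hf' : 0 < ‖f‖ := norm_pos_iff.mpr hf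
    have hle : ‖adjoint Z f‖ ≤ ‖Z‖ * ‖f‖ := by
      simpa only [LinearIsometryEquiv.norm_map] using (adjoint Z).le_opNorm f
    have hlt : ‖adjoint Z f‖ < ‖f‖ := hle.trans_lt (mul_lt_of_lt_one_left hf' h)
    exact sub_pos.mpr (pow_lt_pow_left₀ hlt (norm_nonneg _) two_ne_zero)
  · intro h
    have hcompact : IsCompact (closure (Z '' Metric.closedBall 0 1)) :=
      IsCompactOperator.isCompact_closure_image_closedBall (f := (Z : H →ₗ[ℂ] H)) hZ 1
    have hne : (closure (Z '' Metric.closedBall 0 1)).Nonempty :=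
      ⟨Z 0, subset_closure ⟨0, by simp, rfl⟩⟩
    obtain ⟨y, hy, hmax⟩ := hcompact.exists_isMaxOn hne continuous_norm.continuousOn
    have hZy : ‖Z‖ ≤ ‖y‖ := by
      refine Z.opNorm_le_of_unit_norm (norm_nonneg y) fun x hx => ?_
      exact hmax (subset_closure ⟨x, by simp [hx], rfl⟩)
    refine hZy.trans_lt ?_
    rcases eq_or_ne y 0 with rfl | hy0
    · simp
    -- On the closure of `Z(ball)`, `w ↦ ⟪w, y⟫` is bounded by `‖Z* y‖`.
    have hbound : closure (Z '' Metric.closedBall 0 1) ⊆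
        {w | ‖inner ℂ w y‖ ≤ ‖adjoint Z y‖} := by
      refine closure_minimal ?_ (isClosed_le (by fun_prop) continuous_const)
      rintro _ ⟨x, hx, rfl⟩
      rw [Set.mem_ofPred_eq, ← adjoint_inner_right]
      exact (norm_inner_le_norm _ _).trans
        (mul_le_of_le_one_left (norm_nonneg _) (mem_closedBall_zero_iff.mp hx))
    have hyy : ‖y‖ ^ 2 ≤ ‖adjoint Z y‖ := by
      simpa [inner_self_eq_norm_sq_to_K] using hbound hy
    have hlt : ‖adjoint Z y‖ < ‖y‖ :=
      lt_of_pow_lt_pow_left₀ 2 (norm_nonneg y) (sub_pos.mp (h y hy0))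
    have hpos : 0 < ‖y‖ := norm_pos_iff.mpr hy0
    nlinarith
end

section
/- If the pair (U,V) of bounded linear operators on H satisfies the symplectic relations and Z is a transposition-symmetric bounded operator with ‖Z‖ < 1, then the operators U + V Z*, U* + Z V*, and Ū + V̄ Z are all invertible (have bounded two-sided inverses). -/
open ContinuousLinearMap
open scoped InnerProductSpace

variable {H : Type*} [NormedAddCommGroup H] [InnerProductSpace ℂ H] [CompleteSpace H]

section CStar

variable {A : Type*} [CStarAlgebra A] [PartialOrder A] [StarOrderedRing A]

/-- In a C⋆-algebra, an element `u` with `1 ≤ u * star u` and `1 ≤ star u * u` is invertible. -/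
lemma isUnit_of_one_le_mul_star {u : A} (h₁ : 1 ≤ u * star u) (h₂ : 1 ≤ star u * u) :
    IsUnit u := by
  obtain ⟨b, hb, -⟩ := isUnit_iff_exists.mp (CStarAlgebra.isUnit_of_le 1 h₁)
  obtain ⟨c, -, hc⟩ := isUnit_iff_exists.mp (CStarAlgebra.isUnit_of_le 1 h₂)
  exact isUnit_iff_exists_and_exists.mpr
    ⟨⟨star u * b, by rw [← mul_assoc, hb]⟩, ⟨c * star u, by rw [mul_assoc, hc]⟩⟩

/-- If `u` is invertible and `u * star u - v * star v = 1`, then `u⁻¹ * v` is a contraction. -/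
lemma norm_inv_mul_le_one (u : Aˣ) {v : A} (h : (u : A) * star (u : A) - v * star v = 1) :
    ‖(↑u⁻¹ : A) * v‖ ≤ 1 := by
  have hW : ((↑u⁻¹ : A) * v) * star ((↑u⁻¹ : A) * v) = 1 - (↑u⁻¹ : A) * star (↑u⁻¹ : A) := by
    have hv : v * star v = u * star (u : A) - 1 := by rw [← h]; abel
    have hs : star (u : A) * star (↑u⁻¹ : A) = 1 := by rw [← star_mul]; simp
    calc ((↑u⁻¹ : A) * v) * star ((↑u⁻¹ : A) * v)
        = (↑u⁻¹ : A) * (v * star v) * star (↑u⁻¹ : A) := by simp only [star_mul, mul_assoc]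
      _ = ((↑u⁻¹ : A) * u) * (star (u : A) * star (↑u⁻¹ : A))
            - (↑u⁻¹ : A) * star (↑u⁻¹ : A) := by rw [hv]; noncomm_ring
      _ = _ := by rw [hs, Units.inv_mul, one_mul]
  have hle : ‖((↑u⁻¹ : A) * v) * star ((↑u⁻¹ : A) * v)‖ ≤ 1 := by
    rw [CStarAlgebra.norm_le_one_iff_of_nonneg _ (mul_star_self_nonneg _), hW]
    exact sub_le_self _ (mul_star_self_nonneg _)
  rw [CStarRing.norm_self_mul_star] at hle
  nlinarith [norm_nonneg ((↑u⁻¹ : A) * v)]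

/-- If `u * star u - v * star v = 1` and `star u * u - star w * w = 1`, then `u + v * z` is
invertible for every strict contraction `z`. -/
lemma isUnit_add_mul_of_norm_lt_one {u v w z : A} (h₁ : u * star u - v * star v = 1)
    (h₂ : star u * u - star w * w = 1) (hz : ‖z‖ < 1) : IsUnit (u + v * z) := by
  have hu : IsUnit u := isUnit_of_one_le_mul_star
    (by rw [← h₁]; exact sub_le_self _ (mul_star_self_nonneg _))
    (by rw [← h₂]; exact sub_le_self _ (star_mul_self_nonneg _))
  obtain ⟨u, rfl⟩ := hu
  have hlt : ‖-((↑u⁻¹ : A) * v * z)‖ < 1 := by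
    rw [norm_neg]
    calc ‖(↑u⁻¹ : A) * v * z‖ ≤ ‖(↑u⁻¹ : A) * v‖ * ‖z‖ := norm_mul_le _ _
      _ ≤ 1 * ‖z‖ := by gcongr; exact norm_inv_mul_le_one u h₁
      _ < 1 := by rwa [one_mul]
  have hfac : (u : A) + v * z = u * (1 - -((↑u⁻¹ : A) * v * z)) := by
    simp [mul_add, ← mul_assoc]
  rw [hfac]
  exact u.isUnit.mul (isUnit_one_sub_of_norm_lt_one hlt)

end CStar

section Conjugation

variable {E : Type*} [NormedAddCommGroup E] [InnerProductSpace ℂ E]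

lemma inner_conjugation_conjugation {J : E →L⋆[ℂ] E} (hJnorm : ∀ x, ‖J x‖ = ‖x‖) (x y : E) :
    ⟪J x, J y⟫_ℂ = ⟪y, x⟫_ℂ := by
  have hre : ∀ a b : E, (⟪J a, J b⟫_ℂ).re = (⟪a, b⟫_ℂ).re := fun a b => by
    have h₁ := norm_add_sq (𝕜 := ℂ) a b
    have h₂ := norm_add_sq (𝕜 := ℂ) (J a) (J b)
    rw [← map_add, hJnorm, hJnorm, hJnorm] at h₂
    simp only [RCLike.re_to_complex] at h₁ h₂
    linarith
  rw [← inner_conj_symm y x]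
  apply Complex.ext
  · rw [Complex.conj_re]
    exact hre x y
  · rw [Complex.conj_im]
    simpa [map_smulₛₗ, inner_smul_left, inner_smul_right] using hre x (Complex.I • y)

lemma conjOp_mul {J : E →L⋆[ℂ] E} (hJinv : ∀ x, J (J x) = x) (A B : E →L[ℂ] E) :
    conjOp J (A * B) = conjOp J A * conjOp J B := by
  ext x; simp [conjOp, hJinv]

lemma conjOp_add (J : E →L⋆[ℂ] E) (A B : E →L[ℂ] E) :
    conjOp J (A + B) = conjOp J A + conjOp J B := by
  ext x; simp [conjOp]

lemma conjOp_one {J : E →L⋆[ℂ] E} (hJinv : ∀ x, J (J x) = x) :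
    conjOp J (1 : E →L[ℂ] E) = 1 := by
  ext x; simp [conjOp, hJinv]

lemma IsUnit.conjOp {J : E →L⋆[ℂ] E} (hJinv : ∀ x, J (J x) = x) {A : E →L[ℂ] E}
    (hA : IsUnit A) : IsUnit (conjOp J A) := by
  obtain ⟨B, hAB, hBA⟩ := isUnit_iff_exists.mp hA
  refine isUnit_iff_exists.mpr ⟨_root_.conjOp J B, ?_, ?_⟩
  · rw [← conjOp_mul hJinv, hAB, conjOp_one hJinv]
  · rw [← conjOp_mul hJinv, hBA, conjOp_one hJinv]

/-- The transpose is the adjoint of the complex conjugate. -/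
lemma transp_eq_adjoint_conjOp {J : H →L⋆[ℂ] H} (hJinv : ∀ x, J (J x) = x)
    (hJnorm : ∀ x, ‖J x‖ = ‖x‖) (A : H →L[ℂ] H) : transp J A = adjoint (conjOp J A) := by
  rw [ContinuousLinearMap.eq_adjoint_iff]
  intro x y
  calc ⟪J (adjoint A (J x)), y⟫_ℂ = ⟪J (adjoint A (J x)), J (J y)⟫_ℂ := by rw [hJinv]
    _ = ⟪J (J x), J (A (J y))⟫_ℂ := by
      rw [inner_conjugation_conjugation hJnorm, inner_conjugation_conjugation hJnorm,
        adjoint_inner_right]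
    _ = ⟪x, J (A (J y))⟫_ℂ := by rw [hJinv]

end Conjugation

/-- If `(U,V)` satisfies the symplectic relations and `Z = Zᵀ` with `‖Z‖ < 1`, then
`U + V Z*`, `U* + Z V*` and `Ū + V̄ Z` are invertible. -/
theorem statement8 (J : H →L⋆[ℂ] H) (hJinv : ∀ x, J (J x) = x) (hJnorm : ∀ x, ‖J x‖ = ‖x‖)
    (U V : H →L[ℂ] H) (h : SymplecticPair J U V)
    (Z : H →L[ℂ] H) (hZsym : Z = transp J Z) (hZ : ‖Z‖ < 1) :
    IsUnit (U + V ∘L adjoint Z) ∧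
    IsUnit (adjoint U + Z ∘L adjoint V) ∧
    IsUnit (conjOp J U + conjOp J V ∘L Z) := by
  obtain ⟨h₁, -, h₃, -⟩ := h
  rw [transp_eq_adjoint_conjOp hJinv hJnorm] at h₃
  have hA : IsUnit (U + V * star Z) :=
    isUnit_add_mul_of_norm_lt_one (w := conjOp J V) h₁ h₃ (by rwa [norm_star])
  refine ⟨hA, ?_, ?_⟩
  · have hstar := hA.star
    rwa [star_add, star_mul, star_star] at hstar
  · have hconj := hA.conjOp hJinv
    have hZc : conjOp J (star Z) = Z := hZsym.symm
    rwa [conjOp_add, conjOp_mul hJinv, hZc] at hconj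
end

section
/- Let A be a bounded linear operator on H with ‖A‖ < 1 that is transposition-symmetric, A = J∘A*∘J, and let f ∈ H. Then the operators 1 − A A* and 1 − A* A are invertible, and the vector h := (1 − A A*)⁻¹ f + A (1 − A* A)⁻¹ (J f) satisfies h − A (J h) = f. -/
open ContinuousLinearMap
open scoped InnerProductSpace

variable {H : Type*} [NormedAddCommGroup H] [InnerProductSpace ℂ H] [CompleteSpace H]

/-- If `‖a‖ < 1` and `‖b‖ < 1` in a complete normed ring, then `1 - a * b` is a unit. -/
theorem isUnit_one_sub_mul_of_norm_lt_one {R : Type*} [NormedRing R] [HasSummableGeomSeries R]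
    {a b : R} (ha : ‖a‖ < 1) (hb : ‖b‖ < 1) : IsUnit (1 - a * b) :=
  isUnit_one_sub_of_norm_lt_one <| (norm_mul_le a b).trans_lt <|
    mul_lt_one_of_nonneg_of_lt_one_left (norm_nonneg a) ha hb.le

/-- Applying an invertible operator undoes `Ring.inverse`. -/
theorem IsUnit.apply_ringInverse_apply {E : Type*} [NormedAddCommGroup E] [NormedSpace ℂ E]
    {T : E →L[ℂ] E} (hT : IsUnit T) (x : E) : T (Ring.inverse T x) = x :=
  DFunLike.congr_fun (Ring.mul_inverse_cancel T hT) x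

/-- Applying `Ring.inverse` undoes an invertible operator. -/
theorem IsUnit.ringInverse_apply_apply {E : Type*} [NormedAddCommGroup E] [NormedSpace ℂ E]
    {T : E →L[ℂ] E} (hT : IsUnit T) (x : E) : Ring.inverse T (T x) = x :=
  DFunLike.congr_fun (Ring.inverse_mul_cancel T hT) x

/-- For a transposition-symmetric `A` with `‖A‖ < 1`, the operators `1 − A A*` and `1 − A* A`
are invertible and `h := (1 − A A*)⁻¹ f + A (1 − A* A)⁻¹ (J f)` satisfies `h − A (J h) = f`. -/
theorem statement17 (J : H →L⋆[ℂ] H) (hJinv : ∀ x, J (J x) = x) (hJnorm : ∀ x, ‖J x‖ = ‖x‖)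
    (A : H →L[ℂ] H) (hAnorm : ‖A‖ < 1) (hAsym : A = transp J A) (f : H) :
    IsUnit (1 - A ∘L adjoint A) ∧ IsUnit (1 - adjoint A ∘L A) ∧
    (Ring.inverse (1 - A ∘L adjoint A) f + A (Ring.inverse (1 - adjoint A ∘L A) (J f)))
      - A (J (Ring.inverse (1 - A ∘L adjoint A) f
          + A (Ring.inverse (1 - adjoint A ∘L A) (J f)))) = f := by
  have hnorm : ‖adjoint A‖ < 1 := by rwa [LinearIsometryEquiv.norm_map]
  have hunit : IsUnit (1 - A ∘L adjoint A) := isUnit_one_sub_mul_of_norm_lt_one hAnorm hnorm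
  have hunit' : IsUnit (1 - adjoint A ∘L A) := isUnit_one_sub_mul_of_norm_lt_one hnorm hAnorm
  refine ⟨hunit, hunit', ?_⟩
  have hA (x : H) : A x = J (adjoint A (J x)) := DFunLike.congr_fun hAsym x
  have hAJ (x : H) : A (J x) = J (adjoint A x) := by rw [hA, hJinv]
  have hJA (x : H) : J (A x) = adjoint A (J x) := by rw [hA, hJinv]
  set x := Ring.inverse (1 - A ∘L adjoint A) f
  have hf : x - A (adjoint A x) = f := hunit.apply_ringInverse_apply f
  have hJf : (1 - adjoint A ∘L A) (J x) = J f := by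
    change J x - adjoint A (A (J x)) = J f
    rw [hAJ, ← hJA, ← map_sub, hf]
  rw [← hJf, hunit'.ringInverse_apply_apply, map_add, map_add, hJA, hAJ x, hJinv, ← hf]
  abel
end

section
/- For every natural number n and every real number z with |z| < 1/4, the series ∑_{m=0}^∞ ((2m+2n)! / ((m+n)! · m!)) · z^m converges and its sum equals ((2n)! / n!) · (1 − 4z)^(−(2n+1)/2), where the power is the real power (1 − 4z) ↦ (1 − 4z)^(−(2n+1)/2) of the positive real number 1 − 4z. -/
theorem factorial_two_mul_add_mul_factorial (n m : ℕ) :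
    ((2 * m + 2 * n).factorial : ℝ) * n.factorial =
      (2 * n).factorial * (m + n).factorial * 4 ^ m *
        (ascPochhammer ℝ m).eval ((2 * (n : ℝ) + 1) / 2) := by
  induction m with
  | zero => simp
  | succ m ih =>
    rw [ascPochhammer_succ_eval, show 2 * (m + 1) + 2 * n = 2 * m + 2 * n + 1 + 1 by ring,
      show m + 1 + n = m + n + 1 by ring, Nat.factorial_succ, Nat.factorial_succ,
      Nat.factorial_succ (m + n)]
    push_cast
    linear_combination (2 * (m : ℝ) + 2 * n + 1 + 1) * (2 * m + 2 * n + 1) * ih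

theorem factorial_mul_ring_choose_add_sub_one (a : ℝ) (m : ℕ) :
    (m.factorial : ℝ) * Ring.choose (a + m - 1) m = (ascPochhammer ℝ m).eval a := by
  rw [← Ring.multichoose_eq, ← nsmul_eq_mul, Ring.factorial_nsmul_multichoose_eq_ascPochhammer,
    Polynomial.ascPochhammer_smeval_eq_eval]

/-- For `|z| < 1/4`, `∑_{m=0}^∞ ((2m+2n)!/((m+n)! m!)) zᵐ = ((2n)!/n!) (1 − 4z)^(−(2n+1)/2)`. -/
theorem statement18 (n : ℕ) (z : ℝ) (hz : |z| < 1 / 4) :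
    HasSum
      (fun m : ℕ =>
        ((Nat.factorial (2 * m + 2 * n) : ℝ) /
            ((Nat.factorial (m + n) : ℝ) * (Nat.factorial m : ℝ))) * z ^ m)
      (((Nat.factorial (2 * n) : ℝ) / (Nat.factorial n : ℝ)) *
        (1 - 4 * z) ^ (-((2 * (n : ℝ) + 1) / 2))) := by
  have hlt : |4 * z| < 1 := by
    rw [abs_mul, abs_of_pos (by norm_num : (0 : ℝ) < 4)]
    linarith
  have hpos : 0 ≤ 1 - 4 * z := by linarith [(abs_lt.mp hlt).2]
  have hball : 4 * z ∈ Metric.eball (0 : ℝ) 1 := by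
    rw [← ENNReal.ofReal_one, Metric.eball_ofReal]
    simpa using hlt
  have hsum := ((Real.one_div_one_sub_rpow_hasFPowerSeriesOnBall_zero
    ((2 * (n : ℝ) + 1) / 2)).hasSum hball).mul_left
      ((Nat.factorial (2 * n) : ℝ) / (Nat.factorial n : ℝ))
  simp only [FormalMultilinearSeries.ofScalars_apply_eq, smul_eq_mul, mul_pow, zero_add,
    one_div, ← Real.rpow_neg hpos] at hsum
  refine (congrArg (HasSum · _) (funext fun m => ?_)).mpr hsum
  have h := factorial_two_mul_add_mul_factorial n m
  rw [← factorial_mul_ring_choose_add_sub_one] at h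
  generalize Ring.choose ((2 * (n : ℝ) + 1) / 2 + m - 1) m = c at h ⊢
  field_simp
  linear_combination z ^ m * h
end
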